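/- Let A be a two-sided skew brace such that (A,+) (equivalently (A,∘)) satisfies the maximum condition on subgroups. Then (A,+) is soluble if and only if (A,∘) is soluble, and in that case A is soluble as a skew brace (i.e. the derived series A_1 = A, A_{n+1} = A_n * A_n reaches {0}). -/

import Mathlib

/-- A skew (left) brace: a type with two group structures `(A,+)` and `(A,∘)`
(the latter written multiplicatively) sharing the same identity, satisfying the
left skew brace law `a ∘ (b + c) = a ∘ b − a + a ∘ c`. -/
class SkewBrace (A : Type*) extends AddGroup A, Group A where
  mul_add_eq : ∀ a b c : A, a * (b + c) = a * b - a + a * c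

namespace SkewBrace

variable {A : Type*}

/-- A skew brace is two-sided if `(a + b) ∘ c = a ∘ c − c + b ∘ c`. -/
def IsTwoSided (A : Type*) [SkewBrace A] : Prop :=
  ∀ a b c : A, (a + b) * c = a * c - c + b * c

/-- `a * b = −a + a∘b − b`. -/
def bstar [SkewBrace A] (a b : A) : A := -a + a * b - b

/-- the star operation of the opposite skew brace: `a *ₒₚ b = −b + a∘b − a`. -/
def bstarOp [SkewBrace A] (a b : A) : A := -b + a * b - a

/-- `X * Y`: the additive subgroup generated by all `x * y`, `x ∈ X`, `y ∈ Y`. -/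
def starSet [SkewBrace A] (X Y : Set A) : AddSubgroup A :=
  AddSubgroup.closure {z | ∃ x ∈ X, ∃ y ∈ Y, z = bstar x y}

/-- `A² = A * A`. -/
def sq (A : Type*) [SkewBrace A] : AddSubgroup A := starSet Set.univ Set.univ

/-- `A²ₒₚ`, the additive subgroup generated by all `a *ₒₚ b`. -/
def sqOp (A : Type*) [SkewBrace A] : AddSubgroup A :=
  AddSubgroup.closure {z | ∃ a b : A, z = bstarOp a b}

/-- A skew brace is weakly trivial if `A² ∩ A²ₒₚ = {0}`. -/
def IsWeaklyTrivial (A : Type*) [SkewBrace A] : Prop := sq A ⊓ sqOp A = ⊥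

/-- An ideal of a skew brace: an additive subgroup, normal in `(A,+)` and in
`(A,∘)`, and invariant under all `λ_a : b ↦ −a + a∘b`. -/
structure IsIdeal [SkewBrace A] (I : AddSubgroup A) : Prop where
  add_conj : ∀ a : A, ∀ x ∈ I, a + x - a ∈ I
  mul_conj : ∀ a : A, ∀ x ∈ I, a * x * a⁻¹ ∈ I
  lambda_mem : ∀ a : A, ∀ x ∈ I, -a + a * x ∈ I

/-- The left series `A¹ = A`, `Aⁿ⁺¹ = A * Aⁿ`; `leftSeries A n` is `Aⁿ⁺¹`. -/
def leftSeries (A : Type*) [SkewBrace A] : ℕ → AddSubgroup A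
  | 0 => ⊤
  | n + 1 => starSet Set.univ (leftSeries A n : Set A)

/-- The right series `A⁽¹⁾ = A`, `A⁽ⁿ⁺¹⁾ = A⁽ⁿ⁾ * A`; `rightSeries A n` is `A⁽ⁿ⁺¹⁾`. -/
def rightSeries (A : Type*) [SkewBrace A] : ℕ → AddSubgroup A
  | 0 => ⊤
  | n + 1 => starSet (rightSeries A n : Set A) Set.univ

/-- A skew brace is left nilpotent if its left series reaches `{0}`. -/
def IsLeftNilpotent (A : Type*) [SkewBrace A] : Prop := ∃ n, leftSeries A n = ⊥

/-- A skew brace is right nilpotent if its right series reaches `{0}`. -/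
def IsRightNilpotent (A : Type*) [SkewBrace A] : Prop := ∃ n, rightSeries A n = ⊥

/-- The series `A⁽¹⁾ = A`, `A^[n+1]` generated by the union of `A^[i] * A^[n+1-i]`;
`strongSeries A n` is `A^[n+1]`. -/
def strongSeries (A : Type*) [SkewBrace A] : ℕ → AddSubgroup A
  | 0 => ⊤
  | n + 1 => ⨆ i : Fin (n + 1),
      starSet (strongSeries A i.val : Set A) (strongSeries A (n - i.val) : Set A)
  decreasing_by
  · exact i.isLt
  · have := i.isLt; omega

/-- A skew brace is strongly nilpotent if the series `A^[n]` reaches `{0}`. -/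
def IsStronglyNilpotent (A : Type*) [SkewBrace A] : Prop := ∃ n, strongSeries A n = ⊥

/-- The derived series of a skew brace: `A₁ = A`, `Aₙ₊₁ = Aₙ * Aₙ`;
`derivedSeriesBrace A n` is `Aₙ₊₁`. -/
def derivedSeriesBrace (A : Type*) [SkewBrace A] : ℕ → AddSubgroup A
  | 0 => ⊤
  | n + 1 => starSet (derivedSeriesBrace A n : Set A) (derivedSeriesBrace A n : Set A)

/-- A skew brace is soluble if its derived series reaches `{0}`. -/
def IsSolubleBrace (A : Type*) [SkewBrace A] : Prop := ∃ n, derivedSeriesBrace A n = ⊥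

end SkewBrace
theorem rel_nakayama {U : Type*} [Ring U] (S P : Ideal U) (hS : S.FG)
    (h : S ≤ Ring.jacobson U * S ⊔ P) : S ≤ P := by
  have h1 : Submodule.map P.mkQ S = ⊥ := by
    apply Submodule.FG.eq_bot_of_le_jacobson_smul (Submodule.FG.map _ hS)
    have := Submodule.map_mono (f := P.mkQ) h
    rw [Submodule.map_sup, Submodule.mkQ_map_self, sup_bot_eq] at this
    refine this.trans ?_
    rw [← smul_eq_mul, Submodule.map_smul'']
  intro x hx
  have h2 : P.mkQ x ∈ Submodule.map P.mkQ S := ⟨x, hx, rfl⟩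
  rw [h1, Submodule.mem_bot, Submodule.mkQ_apply, Submodule.Quotient.mk_eq_zero] at h2
  exact h2

def jpow (U : Type*) [Ring U] : ℕ → Ideal U
  | 0 => ⊤
  | n + 1 => Ring.jacobson U * jpow U n

theorem exists_stable (d : ℕ → ℕ) (h : ∀ k, d (k+1) ≤ d k) : ∃ k, d (k+1) = d k := by
  by_contra! hc
  have : StrictAnti d := strictAnti_nat_of_succ_lt fun k => lt_of_le_of_ne (h k) (hc k)
  exact not_strictAnti_of_wellFoundedLT d this

theorem jacobson_nilp (U : Type*) [Ring U] [Module.Finite ℤ U] :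
    ∃ k : ℕ, jpow U k = ⊥ := by
  set J := Ring.jacobson U with hJ
  have hle : ∀ k, jpow U (k+1) ≤ jpow U k := fun k => Ideal.mul_le_right
  have : IsNoetherian ℤ U := inferInstance
  have : IsNoetherianRing U := isNoetherian_of_tower ℤ this
  have hfg : ∀ I : Ideal U, I.FG := fun I => IsNoetherian.noetherian I
  obtain ⟨k, hk⟩ := exists_stable
    (fun k => Module.finrank ℤ ((jpow U k).restrictScalars ℤ)) (fun k => by
      exact Submodule.finrank_mono (fun x hx => hle k hx))
  let S := (jpow U k).restrictScalars ℤ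
  let S' := (jpow U (k+1)).restrictScalars ℤ
  have hS' : S' ≤ S := hle k
  obtain ⟨m, hm0, hm⟩ : ∃ m : ℤ, m ≠ 0 ∧ ∀ x ∈ jpow U k, m • x ∈ jpow U (k+1) := by
    let N := S'.comap S.subtype
    have e : Module.finrank ℤ N = Module.finrank ℤ S' :=
      (Submodule.comapSubtypeEquivOfLe hS').finrank_eq
    have h0 := N.finrank_quotient_add_finrank
    have h1 : Module.finrank ℤ (S ⧸ N) = 0 := by
      have : Module.finrank ℤ S' = Module.finrank ℤ S := hk
      omega
    rw [Module.finrank_eq_zero_iff_isTorsion] at h1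
    have h2 := Submodule.annihilator_top_inter_nonZeroDivisors h1
    obtain ⟨m, hm1, hm2⟩ := h2
    refine ⟨m, nonZeroDivisors.ne_zero hm2, fun x hx => ?_⟩
    have := Submodule.mem_annihilator.1 hm1 (N.mkQ ⟨x, hx⟩) trivial
    rw [← map_smul, Submodule.mkQ_apply, Submodule.Quotient.mk_eq_zero] at this
    exact this
  obtain ⟨p, hp1, hp⟩ := Nat.exists_infinite_primes (m.natAbs + 1)
  have hcop : IsCoprime m (p : ℤ) := by
    rw [Int.isCoprime_iff_gcd_eq_one, Int.gcd_comm]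
    change Nat.gcd _ _ = 1
    rw [Int.natAbs_natCast]
    exact (Nat.Prime.coprime_iff_not_dvd hp).2 fun hd =>
      absurd (Nat.le_of_dvd (Int.natAbs_pos.2 hm0) hd) (by omega)
  obtain ⟨u, v, huv⟩ := hcop
  -- P = p S
  let f : U →ₗ[U] U := LinearMap.toSpanSingleton U U (p : U)
  have hf : ∀ x, f x = (p : ℤ) • x := fun x => by
    simp [f, LinearMap.toSpanSingleton_apply, Nat.cast_comm]
  have hSP : jpow U k ≤ Submodule.map f (jpow U k) := by
    apply rel_nakayama _ _ (hfg _)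
    intro x hx
    have : x = m • (u • x) + (p : ℤ) • (v • x) := by
      rw [smul_smul, smul_smul, ← add_smul, mul_comm m, mul_comm (p:ℤ), huv, one_smul]
    rw [this]
    refine Submodule.add_mem_sup (hm _ (zsmul_mem hx u)) ⟨v • x, zsmul_mem hx v, hf _⟩
  have hSfg : S.FG := IsNoetherian.noetherian S
  obtain ⟨r, hr1, hr⟩ := Submodule.exists_sub_one_mem_and_smul_eq_zero_of_fg_of_le_smul
    (Ideal.span {(p:ℤ)}) S hSfg (by
      intro x hx
      obtain ⟨y, hy, rfl⟩ := hSP hx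
      rw [hf]
      exact Submodule.smul_mem_smul (Ideal.mem_span_singleton_self _) hy)
  have hr0 : r ≠ 0 := by
    rintro rfl
    rw [Ideal.mem_span_singleton] at hr1
    have : (p:ℤ) ∣ 1 := by simpa using hr1
    exact hp.one_lt.ne' (by exact_mod_cast Int.eq_one_of_dvd_one (by positivity) this)
  have hfin : Finite S := by
    apply Module.finite_of_fg_torsion
    intro x
    exact ⟨⟨r, mem_nonZeroDivisors_of_ne_zero hr0⟩, Subtype.ext (hr x x.2)⟩
  have hfinS : ((jpow U k : Ideal U) : Set U).Finite := hfin
  have hle2 : ∀ j, jpow U (k+j) ≤ jpow U k := fun j => by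
    induction j with
    | zero => exact le_rfl
    | succ j ih => exact (hle _).trans ih
  obtain ⟨j, hj⟩ := exists_stable (fun j => ((jpow U (k+j) : Ideal U) : Set U).ncard)
    (fun j => Set.ncard_le_ncard (hle (k+j)) (hfinS.subset (hle2 j)))
  have heq : jpow U (k+j+1) = jpow U (k+j) := by
    apply SetLike.coe_injective
    exact Set.eq_of_subset_of_ncard_le (hle (k+j)) hj.ge (hfinS.subset (hle2 j))
  refine ⟨k+j, Submodule.FG.eq_bot_of_le_jacobson_smul (hfg _) ?_⟩
  exact heq.ge

namespace SkewBrace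

section basic
variable {A : Type*} [SkewBrace A]

theorem mul_zero' (a : A) : a * 0 = a := by
  have h := mul_add_eq a 0 0
  rw [add_zero, sub_eq_add_neg, add_assoc, left_eq_add, neg_add_eq_zero] at h
  exact h.symm

theorem one_eq_zero : (1 : A) = 0 := by
  have := mul_zero' (1 : A)
  rw [one_mul] at this
  exact this.symm

/-- `λ_a`. -/
def lam (a : A) : A →+ A where
  toFun b := -a + a * b
  map_zero' := by rw [mul_zero', neg_add_cancel]
  map_add' b c := by rw [mul_add_eq]; simp only [sub_eq_add_neg, add_assoc]

theorem lam_apply (a b : A) : lam a b = -a + a * b := rfl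

theorem mul_eq_lam (a b : A) : a * b = a + lam a b := by
  rw [lam_apply, add_neg_cancel_left]

theorem lam_mul (a b c : A) : lam (a * b) c = lam a (lam b c) := by
  rw [lam_apply b c, map_add, map_neg, lam_apply a b, lam_apply a (b * c), lam_apply, mul_assoc]
  simp [add_assoc]

theorem lam_one (c : A) : lam (1 : A) c = c := by
  rw [lam_apply, one_mul, one_eq_zero, neg_zero, zero_add]

theorem inv_eq_lam (a : A) : a⁻¹ = lam a⁻¹ (-a) := by
  rw [map_neg, lam_apply, inv_mul_cancel, one_eq_zero, add_zero, neg_neg]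

theorem bstar_eq (a b : A) : bstar a b = lam a b - b := rfl

theorem mul_eq_bstar (a b : A) : a * b = a + bstar a b + b := by
  simp [bstar, sub_eq_add_neg, add_assoc]

theorem mul_eq_bstarOp (a b : A) : a * b = b + bstarOp a b + a := by
  simp [bstarOp, sub_eq_add_neg, add_assoc]

/-- Sub skew brace. -/
@[reducible] def subBrace (D : AddSubgroup A) (hm : ∀ x ∈ D, ∀ y ∈ D, x * y ∈ D)
    (hi : ∀ x ∈ D, x⁻¹ ∈ D) : SkewBrace D :=
  { (inferInstance : AddGroup D) with
    mul := fun x y => ⟨x * y, hm x x.2 y y.2⟩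
    one := ⟨1, by rw [one_eq_zero]; exact D.zero_mem⟩
    inv := fun x => ⟨(x : A)⁻¹, hi x x.2⟩
    mul_assoc := fun x y z => Subtype.ext (mul_assoc (x : A) y z)
    one_mul := fun x => Subtype.ext (one_mul (x : A))
    mul_one := fun x => Subtype.ext (mul_one (x : A))
    inv_mul_cancel := fun x => Subtype.ext (inv_mul_cancel (x : A))
    mul_add_eq := fun x y z => Subtype.ext (mul_add_eq (x : A) y z) }

theorem derived_le_map (D : AddSubgroup A) (hm : ∀ x ∈ D, ∀ y ∈ D, x * y ∈ D)
    (hi : ∀ x ∈ D, x⁻¹ ∈ D) (m : ℕ) (h : derivedSeriesBrace A m ≤ D) (k : ℕ) :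
    derivedSeriesBrace A (m + k) ≤
      AddSubgroup.map D.subtype (@derivedSeriesBrace D (subBrace D hm hi) k) := by
  letI := subBrace D hm hi
  induction k with
  | zero => intro x hx; exact ⟨⟨x, h hx⟩, trivial, rfl⟩
  | succ k ih =>
    change AddSubgroup.closure _ ≤ _
    rw [AddSubgroup.closure_le]
    rintro z ⟨x, hx, y, hy, rfl⟩
    obtain ⟨x', hx', rfl⟩ := ih hx
    obtain ⟨y', hy', rfl⟩ := ih hy
    exact ⟨bstar x' y', AddSubgroup.subset_closure ⟨x', hx', y', hy', rfl⟩, rfl⟩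

theorem map_le_derived (D : AddSubgroup A) (hm : ∀ x ∈ D, ∀ y ∈ D, x * y ∈ D)
    (hi : ∀ x ∈ D, x⁻¹ ∈ D) (m : ℕ) (h : D ≤ derivedSeriesBrace A m) (k : ℕ) :
      AddSubgroup.map D.subtype (@derivedSeriesBrace D (subBrace D hm hi) k) ≤
    derivedSeriesBrace A (m + k) := by
  letI := subBrace D hm hi
  induction k with
  | zero => rintro _ ⟨x, -, rfl⟩; exact h x.2
  | succ k ih =>
    rw [AddSubgroup.map_le_iff_le_comap]
    change AddSubgroup.closure _ ≤ _
    rw [AddSubgroup.closure_le]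
    rintro z ⟨x, hx, y, hy, rfl⟩
    exact AddSubgroup.subset_closure
      ⟨x, ih ⟨x, hx, rfl⟩, y, ih ⟨y, hy, rfl⟩, rfl⟩

theorem normal_closure_of {S : Set A} (h : ∀ s ∈ S, ∀ g : A, g + s - g ∈ AddSubgroup.closure S) :
    (AddSubgroup.closure S).Normal := by
  refine ⟨fun n hn g => ?_⟩
  rw [← sub_eq_add_neg]
  induction hn using AddSubgroup.closure_induction with
  | mem x hx => exact h x hx g
  | zero => simp
  | add x y _ _ hx hy =>
    have : g + (x + y) - g = (g + x - g) + (g + y - g) := by simp [sub_eq_add_neg, add_assoc]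
    rw [this]; exact add_mem hx hy
  | neg x _ hx =>
    have : g + -x - g = -(g + x - g) := by simp [sub_eq_add_neg, add_assoc]
    rw [this]; exact neg_mem hx

theorem bstar_mem_sq (a b : A) : bstar a b ∈ sq A :=
  AddSubgroup.subset_closure ⟨a, trivial, b, trivial, rfl⟩

theorem bstarOp_mem_sqOp (a b : A) : bstarOp a b ∈ sqOp A :=
  AddSubgroup.subset_closure ⟨a, b, rfl⟩

instance sq_normal : (sq A).Normal := by
  apply normal_closure_of
  rintro _ ⟨a, -, c, -, rfl⟩ b
  have : b + bstar a c - b = -bstar a b + bstar a (b + c) := by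
    simp only [bstar, mul_add_eq, sub_eq_add_neg, neg_add_rev, neg_neg, add_assoc,
      neg_add_cancel_left, add_neg_cancel_left]
  rw [this]
  exact add_mem (neg_mem (bstar_mem_sq _ _)) (bstar_mem_sq _ _)

instance sqOp_normal : (sqOp A).Normal := by
  apply normal_closure_of
  rintro _ ⟨a, b, rfl⟩ c
  have : c + bstarOp a b - c = bstarOp a (b + -c) - bstarOp a (-c) := by
    simp only [bstarOp, mul_add_eq, sub_eq_add_neg, neg_add_rev, neg_neg, add_assoc,
      neg_add_cancel_left, add_neg_cancel_left, add_neg_cancel, neg_add_cancel, add_zero]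
  rw [this]
  exact sub_mem (bstarOp_mem_sqOp _ _) (bstarOp_mem_sqOp _ _)

/-- `(A,∘) → A/A²`. -/
def toQ : A →* Multiplicative (A ⧸ sq A) where
  toFun a := Multiplicative.ofAdd (a : A ⧸ sq A)
  map_one' := by rw [one_eq_zero]; rfl
  map_mul' a b := by
    rw [mul_eq_bstar]
    have : ((bstar a b : A) : A ⧸ sq A) = 0 :=
      (QuotientAddGroup.eq_zero_iff _).2 (bstar_mem_sq a b)
    rw [QuotientAddGroup.mk_add, QuotientAddGroup.mk_add, this, add_zero]; rfl

/-- `(A,∘) → A/A²ₒₚ`. -/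
def toQop : A →* Multiplicative (A ⧸ sqOp A) where
  toFun a := Multiplicative.ofAdd (-(a : A ⧸ sqOp A))
  map_one' := by rw [one_eq_zero, QuotientAddGroup.mk_zero, neg_zero]; rfl
  map_mul' a b := by
    rw [mul_eq_bstarOp]
    have : ((bstarOp a b : A) : A ⧸ sqOp A) = 0 :=
      (QuotientAddGroup.eq_zero_iff _).2 (bstarOp_mem_sqOp a b)
    rw [QuotientAddGroup.mk_add, QuotientAddGroup.mk_add, this, add_zero, neg_add_rev]; rfl

theorem sq_mul : ∀ x ∈ sq A, ∀ y ∈ sq A, x * y ∈ sq A := fun x hx y hy => by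
  rw [mul_eq_bstar]
  exact add_mem (add_mem hx (bstar_mem_sq _ _)) hy

theorem sq_inv : ∀ x ∈ sq A, x⁻¹ ∈ sq A := fun x hx => by
  have h := mul_eq_bstar x x⁻¹
  rw [mul_inv_cancel, one_eq_zero, eq_comm] at h
  rw [← neg_eq_of_add_eq_zero_right h]
  exact neg_mem (add_mem hx (bstar_mem_sq _ _))

theorem commute_star (h : IsTwoSided A) (a b c d : A) :
    bstarOp b c + bstar a d = bstar a d + bstarOp b c := by
  have h1 : (a + b) * (c + d) = a * c + (bstarOp b c + bstar a d) + b * d := by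
    rw [mul_add_eq, h, h]
    simp [bstar, bstarOp, sub_eq_add_neg, add_assoc]
  have h2 : (a + b) * (c + d) = a * c + (bstar a d + bstarOp b c) + b * d := by
    rw [h, mul_add_eq, mul_add_eq]
    simp [bstar, bstarOp, sub_eq_add_neg, add_assoc]
  exact add_left_cancel (add_right_cancel (h1.symm.trans h2))

theorem commute_sq (h : IsTwoSided A) {x y : A} (hx : x ∈ sq A) (hy : y ∈ sqOp A) :
    x + y = y + x := by
  have key : sq A ≤ AddSubgroup.centralizer (sqOp A : Set A) := by
    unfold sqOp
    rw [AddSubgroup.centralizer_closure]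
    refine (AddSubgroup.closure_le _).2 ?_
    rintro _ ⟨a, -, d, -, rfl⟩
    simp only [SetLike.mem_coe, AddSubgroup.mem_iInf, AddSubgroup.mem_centralizer_singleton_iff]
    rintro _ ⟨b, c, rfl⟩
    first | exact commute_star h _ _ _ _ | exact (commute_star h _ _ _ _).symm
  exact ((AddSubgroup.mem_centralizer_iff.1 (key hx)) y hy).symm

open Group in
theorem add_solvable (h : IsTwoSided A) (hs : Group.IsSolvable A) :
    Group.IsSolvable (Multiplicative A) := by
  have h1 : Group.IsSolvable (Multiplicative (A ⧸ sq A)) :=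
    isSolvable_of_surjective (f := toQ) fun x => QuotientAddGroup.mk_surjective x
  have h2 : Group.IsSolvable (Multiplicative (A ⧸ sqOp A)) :=
    isSolvable_of_surjective (f := toQop) fun x => by
      obtain ⟨y, hy⟩ := QuotientAddGroup.mk_surjective (-(Multiplicative.toAdd x))
      exact ⟨y, by change Multiplicative.ofAdd (-(y : A ⧸ sqOp A)) = x; rw [hy, neg_neg]; rfl⟩
  let I := (sq A ⊓ sqOp A)
  have h3 : Group.IsSolvable (Multiplicative I) := by
    apply Group.isSolvable_of_comm
    intro a b
    exact Subtype.ext (commute_sq h a.toAdd.2.1 b.toAdd.2.2)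
  refine isSolvable_of_ker_le_range (AddMonoidHom.toMultiplicative I.subtype)
    (MonoidHom.prod (AddMonoidHom.toMultiplicative (QuotientAddGroup.mk' (sq A)))
      (AddMonoidHom.toMultiplicative (QuotientAddGroup.mk' (sqOp A)))) ?_
  intro x hx
  rw [MonoidHom.mem_ker] at hx
  have e1 : ((Multiplicative.toAdd x : A) : A ⧸ sq A) = 0 := congrArg Prod.fst hx
  have e2 : ((Multiplicative.toAdd x : A) : A ⧸ sqOp A) = 0 := congrArg Prod.snd hx
  rw [QuotientAddGroup.eq_zero_iff] at e1 e2
  exact ⟨Multiplicative.ofAdd ⟨Multiplicative.toAdd x, e1, e2⟩, rfl⟩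

end basic

open Group in
theorem mul_solvable (n : ℕ) : ∀ (A : Type*) [SkewBrace A],
    Group.IsSolvable (Multiplicative A) → derivedSeriesBrace A n = ⊥ → Group.IsSolvable A := by
  induction n with
  | zero =>
    intro A _ _ h
    have : ∀ x : A, x = 0 := fun x => by
      have : x ∈ derivedSeriesBrace A 0 := trivial
      rwa [h, AddSubgroup.mem_bot] at this
    exact Group.isSolvable_of_comm fun a b => by rw [this (a * b), this (b * a)]
  | succ n ih =>
    intro A _ hs h
    letI := subBrace (sq A) sq_mul sq_inv
    have h0 : Group.IsSolvable (Multiplicative (sq A)) :=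
      isSolvable_of_isSolvable_injective (f := AddMonoidHom.toMultiplicative (sq A).subtype)
        Subtype.val_injective
    have h1 : Group.IsSolvable (sq A) := by
      refine ih _ h0 ?_
      have := map_le_derived (sq A) sq_mul sq_inv 1 (by
        exact AddSubgroup.closure_mono fun z ⟨x, _, y, _, e⟩ => ⟨x, trivial, y, trivial, e⟩) n
      rw [add_comm 1 n, h, le_bot_iff] at this
      exact (AddSubgroup.map_eq_bot_iff_of_injective _ Subtype.val_injective).1 this
    have h2 : Group.IsSolvable (Multiplicative (A ⧸ sq A)) :=
      isSolvable_of_surjective (f := AddMonoidHom.toMultiplicative (QuotientAddGroup.mk' (sq A)))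
        fun x => QuotientAddGroup.mk_surjective x
    let f : sq A →* A := { toFun := Subtype.val, map_one' := rfl, map_mul' := fun _ _ => rfl }
    refine isSolvable_of_ker_le_range f toQ ?_
    intro x hx
    have e1 : (x : A ⧸ sq A) = 0 := hx
    rw [QuotientAddGroup.eq_zero_iff] at e1
    exact ⟨⟨x, e1⟩, rfl⟩

end SkewBrace

namespace SkewBrace

section ab
variable (A : Type*) [SkewBrace A]

/-- The additive abelianization. -/
abbrev AQ := Additive (Abelianization (Multiplicative A))

variable {A}

/-- The projection to the additive abelianization. -/
def aπ : A →+ AQ A where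
  toFun a := Additive.ofMul (Abelianization.of (Multiplicative.ofAdd a))
  map_zero' := rfl
  map_add' _ _ := rfl

theorem aπ_surj : Function.Surjective (aπ (A := A)) := by
  intro q
  obtain ⟨x, hx⟩ := QuotientGroup.mk_surjective (Additive.toMul q)
  exact ⟨Multiplicative.toAdd x, congrArg Additive.ofMul hx⟩

/-- The universal property. -/
def aLift {G : Type*} [AddCommGroup G] (f : A →+ G) : AQ A →+ G :=
  MonoidHom.toAdditiveLeft (Abelianization.lift (AddMonoidHom.toMultiplicative f))

theorem aLift_apply {G : Type*} [AddCommGroup G] (f : A →+ G) (a : A) :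
    aLift f (aπ a) = f a := rfl

/-- `λ_a` on the abelianization. -/
def ell (a : A) : AddMonoid.End (AQ A) := aLift ((aπ (A := A)).comp (lam a))

theorem ell_apply (a b : A) : ell a (aπ b) = aπ (lam a b) := rfl

theorem end_ext {f g : AddMonoid.End (AQ A)} (h : ∀ a : A, f (aπ a) = g (aπ a)) : f = g := by
  apply AddMonoidHom.ext
  intro q
  obtain ⟨a, rfl⟩ := aπ_surj q
  exact h a

theorem ell_mul (a b : A) : ell (a * b) = ell a * ell b := by
  apply end_ext
  intro c
  change aπ (lam (a * b) c) = aπ (lam a (lam b c))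
  rw [lam_mul]

theorem ell_one : ell (1 : A) = 1 := by
  apply end_ext
  intro c
  change aπ (lam 1 c) = aπ c
  rw [lam_one]

theorem ell_sub_apply (a b : A) : (ell a - 1) (aπ b) = aπ (bstar a b) := by
  rw [bstar_eq, map_sub]; rfl

/-- `a ↦ L_a`, with `L_a(b) = a * b`. -/
def LL (h : IsTwoSided A) : A →+ AddMonoid.End (AQ A) :=
  AddMonoidHom.mk' (fun a => ell a - 1) (by
    intro a b
    apply end_ext
    intro c
    rw [ell_sub_apply]
    change _ = (ell a - 1) (aπ c) + (ell b - 1) (aπ c)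
    rw [ell_sub_apply, ell_sub_apply]
    have : bstar (a + b) c = -b + bstar a c + b + bstar b c := by
      simp [bstar, h a b c, sub_eq_add_neg, add_assoc]
    rw [this, map_add, map_add, map_add, map_neg]
    abel)

theorem LL_apply (h : IsTwoSided A) (a b : A) : LL h a (aπ b) = aπ (bstar a b) :=
  ell_sub_apply a b

theorem LL_eq (h : IsTwoSided A) (a : A) : LL h a = ell a - 1 := rfl

theorem LL_bstar (h : IsTwoSided A) (a b : A) : LL h (bstar a b) = LL h a * LL h b := by
  have h1 : LL h (a * b) = LL h a + LL h (bstar a b) + LL h b := by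
    rw [mul_eq_bstar, map_add, map_add]
  have h2 : LL h (a * b) = LL h a + LL h a * LL h b + LL h b := by
    simp only [LL_eq, ell_mul, sub_mul, mul_sub, one_mul, mul_one]
    abel
  exact add_left_cancel (add_right_cancel (h1.symm.trans h2))

/-- The ring `ℤ + L_A`. -/
def WW (h : IsTwoSided A) : Subring (AddMonoid.End (AQ A)) where
  carrier := {x | ∃ (n : ℤ) (a : A), x = n + LL h a}
  zero_mem' := ⟨0, 0, by simp⟩
  one_mem' := ⟨1, 0, by simp⟩
  add_mem' := by
    rintro _ _ ⟨n, a, rfl⟩ ⟨m, b, rfl⟩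
    exact ⟨n + m, a + b, by rw [map_add]; push_cast; abel⟩
  neg_mem' := by
    rintro _ ⟨n, a, rfl⟩
    exact ⟨-n, -a, by rw [map_neg]; push_cast; abel⟩
  mul_mem' := by
    rintro _ _ ⟨n, a, rfl⟩ ⟨m, b, rfl⟩
    refine ⟨n * m, n • b + m • a + bstar a b, ?_⟩
    rw [map_add, map_add, map_zsmul, map_zsmul, LL_bstar, zsmul_eq_mul, zsmul_eq_mul,
      (Int.cast_commute m (LL h a)).eq]
    push_cast
    noncomm_ring

theorem LL_mem (h : IsTwoSided A) (a : A) : LL h a ∈ WW h := ⟨0, a, by simp⟩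

/-- `L_a` as an element of `WW`. -/
def LW (h : IsTwoSided A) (a : A) : WW h := ⟨LL h a, LL_mem h a⟩

theorem LW_mem_jac (h : IsTwoSided A) (a : A) : LW h a ∈ Ring.jacobson (WW h) := by
  rw [← Ideal.jacobson_bot, Ideal.mem_jacobson_iff]
  rintro ⟨_, n, b, rfl⟩
  let c := n • a + bstar b a
  have hc : (n + LL h b) * LL h a = LL h c := by
    rw [map_add, LL_bstar, map_zsmul, zsmul_eq_mul, add_mul]
  have hz : ell c⁻¹ ∈ WW h := ⟨1, c⁻¹, by rw [LL_eq]; simp⟩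
  refine ⟨⟨ell c⁻¹, hz⟩, ?_⟩
  rw [Ideal.mem_bot]
  apply Subtype.ext
  change ell c⁻¹ * (n + LL h b) * LL h a + ell c⁻¹ - 1 = 0
  rw [mul_assoc, hc, LL_eq, mul_sub, ← ell_mul, inv_mul_cancel, ell_one, mul_one]
  abel

theorem finite_AQ [WellFoundedGT (AddSubgroup A)] : Module.Finite ℤ (AQ A) := by
  have h1 : WellFoundedGT (AddSubgroup (AQ A)) := by
    have : StrictMono (AddSubgroup.comap (aπ (A := A))) := by
      apply Monotone.strictMono_of_injective
      · intro x y hxy; exact AddSubgroup.comap_mono hxy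
      · exact AddSubgroup.comap_injective aπ_surj
    exact this.wellFoundedGT
  have h2 : WellFoundedGT (Submodule ℤ (AQ A)) :=
    (AddSubgroup.toIntSubmodule (M := AQ A)).symm.strictMono.wellFoundedGT
  have : IsNoetherian ℤ (AQ A) := isNoetherian_iff'.2 h2
  infer_instance

theorem finite_WW (h : IsTwoSided A) [WellFoundedGT (AddSubgroup A)] :
    Module.Finite ℤ (WW h) := by
  have := finite_AQ (A := A)
  let LA : A →+ WW h := AddMonoidHom.mk' (LW h) fun a b => Subtype.ext (map_add (LL h) a b)
  let g : ℤ × AQ A →+ WW h := AddMonoidHom.coprod (Int.castAddHom (WW h)) (aLift LA)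
  apply Module.Finite.of_surjective g.toIntLinearMap
  rintro ⟨_, n, a, rfl⟩
  exact ⟨(n, aπ a), Subtype.ext (by
    change ((((n : ℤ) : WW h) + LW h a : WW h) : AddMonoid.End (AQ A)) = _
    push_cast; rfl)⟩

theorem LW_mem_jpow (h : IsTwoSided A) (n : ℕ) :
    ∀ a ∈ derivedSeriesBrace A n, LW h a ∈ jpow (WW h) n := by
  induction n with
  | zero => intro a _; exact trivial
  | succ n ih =>
    intro a ha
    let LA : A →+ WW h := AddMonoidHom.mk' (LW h) fun a b => Subtype.ext (map_add (LL h) a b)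
    suffices hh : derivedSeriesBrace A (n + 1) ≤
        (jpow (WW h) (n + 1)).toAddSubgroup.comap LA from hh ha
    refine (AddSubgroup.closure_le _).2 ?_
    rintro _ ⟨x, hx, y, hy, rfl⟩
    change LW h (bstar x y) ∈ jpow (WW h) (n + 1)
    have : LW h (bstar x y) = LW h x * LW h y := Subtype.ext (LL_bstar h x y)
    rw [this]
    exact Ideal.mul_mem_mul (LW_mem_jac h x) (ih y hy)

theorem exists_derived_le (h : IsTwoSided A) [WellFoundedGT (AddSubgroup A)] :
    ∃ k, derivedSeriesBrace A k ≤ (aπ (A := A)).ker := by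
  have := finite_WW h
  obtain ⟨k, hk⟩ := jacobson_nilp (WW h)
  refine ⟨k + 1, (AddSubgroup.closure_le _).2 ?_⟩
  rintro _ ⟨x, hx, y, hy, rfl⟩
  have h1 := LW_mem_jpow h k x hx
  rw [hk, Ideal.mem_bot] at h1
  have h2 : LL h x = 0 := congrArg Subtype.val h1
  change aπ (bstar x y) = 0
  rw [← LL_apply h, h2]; rfl

theorem ker_lam (a x : A) (hx : x ∈ (aπ (A := A)).ker) : lam a x ∈ (aπ (A := A)).ker := by
  rw [AddMonoidHom.mem_ker] at *
  rw [← ell_apply, hx, map_zero]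

theorem ker_mul : ∀ x ∈ (aπ (A := A)).ker, ∀ y ∈ (aπ (A := A)).ker, x * y ∈ (aπ (A := A)).ker :=
  fun x hx y hy => by
    rw [mul_eq_lam]; exact add_mem hx (ker_lam _ _ hy)

theorem ker_inv : ∀ x ∈ (aπ (A := A)).ker, x⁻¹ ∈ (aπ (A := A)).ker :=
  fun x hx => by
    rw [inv_eq_lam]; exact ker_lam _ _ (neg_mem hx)

theorem derived_ker_le (n : ℕ) :
    (derivedSeries (Multiplicative (aπ (A := A)).ker) n).map
      (AddMonoidHom.toMultiplicative (aπ (A := A)).ker.subtype) ≤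
    derivedSeries (Multiplicative A) (n + 1) := by
  induction n with
  | zero =>
    rintro _ ⟨x, -, rfl⟩
    exact (QuotientGroup.eq_one_iff _).1 x.toAdd.2
  | succ n ih =>
    rw [derivedSeries_succ, Subgroup.map_commutator, derivedSeries_succ _ (n + 1)]
    exact Subgroup.commutator_mono ih ih

end ab

theorem soluble_of_add (n : ℕ) : ∀ (A : Type*) [SkewBrace A], IsTwoSided A →
    WellFoundedGT (AddSubgroup A) → derivedSeries (Multiplicative A) n = ⊥ →
    IsSolubleBrace A := by
  induction n with
  | zero =>
    intro A _ _ _ hs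
    refine ⟨0, ?_⟩
    rw [eq_bot_iff]
    intro x _
    have : Multiplicative.ofAdd x ∈ derivedSeries (Multiplicative A) 0 := trivial
    rw [hs] at this
    exact this
  | succ n ih =>
    intro A _ h hw hs
    obtain ⟨k, hk⟩ := exists_derived_le h
    let I := (aπ (A := A)).ker
    let _ : SkewBrace I := subBrace I ker_mul ker_inv
    have hI : IsTwoSided I := fun a b c => Subtype.ext (h a b c)
    have hwI : WellFoundedGT (AddSubgroup I) := by
      have : StrictMono (AddSubgroup.map I.subtype) := by
        apply Monotone.strictMono_of_injective
        · intro x y hxy; exact AddSubgroup.map_mono hxy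
        · exact AddSubgroup.map_injective Subtype.val_injective
      exact this.wellFoundedGT
    have hsI : derivedSeries (Multiplicative I) n = ⊥ := by
      have := derived_ker_le (A := A) n
      rw [hs, le_bot_iff] at this
      exact (Subgroup.map_eq_bot_iff_of_injective _ Subtype.val_injective).1 this
    obtain ⟨m, hm⟩ := ih I hI hwI hsI
    refine ⟨k + m, ?_⟩
    have := derived_le_map I ker_mul ker_inv k hk m
    rw [hm, AddSubgroup.map_bot, le_bot_iff] at this
    exact this

theorem wf_of_max (A : Type*) [AddGroup A] (hmax : ¬ ∃ f : ℕ → AddSubgroup A, StrictMono f) :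
    WellFoundedGT (AddSubgroup A) := by
  constructor
  rw [wellFounded_iff_isEmpty_descending_chain]
  refine ⟨fun f => hmax ⟨f.1, strictMono_nat_of_lt_succ fun n => f.2 n⟩⟩

end SkewBrace

open SkewBrace in
/-- For a two-sided skew brace satisfying the maximum condition on subgroups, `(A,+)`
is soluble iff `(A,∘)` is soluble, and in that case `A` is soluble as a skew brace. -/
theorem solvable_iff_of_max_condition (A : Type*) [SkewBrace A] (h : IsTwoSided A)
    (hmax : ¬ ∃ f : ℕ → AddSubgroup A, StrictMono f) :
    (IsSolvable (Multiplicative A) ↔ IsSolvable A) ∧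
    (IsSolvable (Multiplicative A) → IsSolubleBrace A) := by
  have key : Group.IsSolvable (Multiplicative A) → IsSolubleBrace A := fun hs => by
    obtain ⟨n, hn⟩ := hs.solvable
    exact soluble_of_add n A h (wf_of_max A hmax) hn
  refine ⟨⟨fun hs => ?_, fun hs => add_solvable h hs⟩, key⟩
  obtain ⟨n, hn⟩ := key hs
  exact mul_solvable n A hs hn
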